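/- arXiv:cs/0504004 — 3 statements merged into one kernel-verified Lean document; each statement's English description precedes it below -/
import Mathlib

section
/- Let (ρ_n) be a sequence of positive reals and η ∈ ℝ such that n·ρ_n − ln n → η as n → ∞. Then for every k ∈ ℕ, the probability that the 1-dimensional MANET with disconnected boundary conditions is disconnected at exactly k places satisfies P_{DISC-DB(k)}(n, ρ_n) → (e^{−ηk}/k!) · exp(−e^{−η}) as n → ∞; in particular, the probability of connectedness satisfies P_{CONN-DB}(n, ρ_n) → exp(−e^{−η}). -/
open MeasureTheory Filter

/-- The coordinates of `x` sorted in nondecreasing order. -/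
noncomputable def sortedCoords {n : ℕ} (x : Fin n → ℝ) : Fin n → ℝ :=
  fun i => x (Tuple.sort x i)

/-- The circular gaps of `x`: for `i+1 < n` the gap `x'_{i+1} - x'_i` between consecutive
sorted coordinates, and for the last index the boundary gap `x'_1 + 1 - x'_n`. -/
noncomputable def circGap {n : ℕ} (x : Fin n → ℝ) (i : Fin n) : ℝ :=
  if h : (i : ℕ) + 1 < n then sortedCoords x ⟨(i : ℕ) + 1, h⟩ - sortedCoords x i
  else sortedCoords x ⟨0, i.pos⟩ + 1 - sortedCoords x i

/-- The unit cube `[0,1]^n`, the sample space of the normalized model. -/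
def unitBox (n : ℕ) : Set (Fin n → ℝ) := Set.univ.pi fun _ => Set.Icc (0 : ℝ) 1

/-- The event DISC-PB(k): exactly `k` circular gaps are `≥ ρ`. -/
def discPB (n : ℕ) (ρ : ℝ) (k : ℕ) : Set (Fin n → ℝ) :=
  {x ∈ unitBox n | Nat.card {i : Fin n // ρ ≤ circGap x i} = k}

/-- The probability of DISC-PB(k). -/
noncomputable def P_discPB (n : ℕ) (ρ : ℝ) (k : ℕ) : ℝ :=
  (volume (discPB n ρ k)).toReal

/-- The event CONN-PB: all circular gaps are `< ρ`. -/
def connPB (n : ℕ) (ρ : ℝ) : Set (Fin n → ℝ) :=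
  {x ∈ unitBox n | ∀ i, circGap x i < ρ}

/-- The probability of CONN-PB. -/
noncomputable def P_connPB (n : ℕ) (ρ : ℝ) : ℝ :=
  (volume (connPB n ρ)).toReal

/-- The event DISC-DB(k): exactly `k` of the non-circular gaps
`x'_{i+1} - x'_i`, `i = 1, …, n-1`, are `≥ ρ`. -/
def discDB (n : ℕ) (ρ : ℝ) (k : ℕ) : Set (Fin n → ℝ) :=
  {x ∈ unitBox n | Nat.card {i : Fin n // (i : ℕ) + 1 < n ∧ ρ ≤ circGap x i} = k}

/-- The probability of DISC-DB(k). -/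
noncomputable def P_discDB (n : ℕ) (ρ : ℝ) (k : ℕ) : ℝ :=
  (volume (discDB n ρ k)).toReal

/-- The event CONN-DB: all gaps between consecutive sorted coordinates are `< ρ`. -/
def connDB (n : ℕ) (ρ : ℝ) : Set (Fin n → ℝ) :=
  {x ∈ unitBox n | ∀ i : Fin n, ∀ h : (i : ℕ) + 1 < n,
    sortedCoords x ⟨(i : ℕ) + 1, h⟩ - sortedCoords x i < ρ}

/-- The probability of CONN-DB. -/
noncomputable def P_connDB (n : ℕ) (ρ : ℝ) : ℝ :=
  (volume (connDB n ρ)).toReal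

/-- The event S: the network is disconnected at the boundary,
`min_i x_i + 1 - max_i x_i ≥ ρ`. -/
def boundaryDisc (n : ℕ) (ρ : ℝ) : Set (Fin n → ℝ) :=
  {x ∈ unitBox n | ρ ≤ (⨅ i, x i) + 1 - (⨆ i, x i)}

/-- The set of points whose coordinates are in nondecreasing order after permuting by `σ`. -/
def sortedRegion {n : ℕ} (σ : Equiv.Perm (Fin n)) : Set (Fin n → ℝ) :=
  {x | Monotone (x ∘ σ)}

lemma measurableSet_sortedRegion {n : ℕ} (σ : Equiv.Perm (Fin n)) :
    MeasurableSet (sortedRegion σ) := by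
  have hc : IsClosed ((fun x : Fin n → ℝ => x ∘ σ) ⁻¹' {f | Monotone f}) :=
    isClosed_monotone.preimage (by fun_prop)
  exact hc.measurableSet

lemma sortedCoords_of_mem_sortedRegion {n : ℕ} {σ : Equiv.Perm (Fin n)} {x : Fin n → ℝ}
    (hx : x ∈ sortedRegion σ) : sortedCoords x = x ∘ σ :=
  (Tuple.comp_sort_eq_comp_iff_monotone.2 hx).symm

lemma iUnion_sortedRegion (n : ℕ) : ⋃ σ : Equiv.Perm (Fin n), sortedRegion σ = Set.univ :=
  Set.eq_univ_of_forall fun x => Set.mem_iUnion.2 ⟨Tuple.sort x, Tuple.monotone_sort x⟩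

lemma volume_setOf_apply_eq_apply {n : ℕ} {i j : Fin n} (hij : i ≠ j) :
    volume {x : Fin n → ℝ | x i = x j} = 0 := by
  have h := Measure.addHaar_submodule (volume : Measure (Fin n → ℝ))
    (LinearMap.ker ((LinearMap.proj i : (Fin n → ℝ) →ₗ[ℝ] ℝ) - LinearMap.proj j)) (by
      intro htop
      have hmem : (Pi.single i 1 : Fin n → ℝ) ∈
          LinearMap.ker ((LinearMap.proj i : (Fin n → ℝ) →ₗ[ℝ] ℝ) - LinearMap.proj j) := by
        rw [htop]; trivial
      simp [hij.symm] at hmem)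
  convert! h using 2
  ext x
  exact sub_eq_zero.symm

lemma aedisjoint_sortedRegion {n : ℕ} :
    Pairwise fun σ τ : Equiv.Perm (Fin n) =>
      AEDisjoint volume (sortedRegion σ) (sortedRegion τ) := by
  intro σ τ hστ
  obtain ⟨i, hi⟩ : ∃ i, σ i ≠ τ i := by
    by_contra! hall
    exact hστ (Equiv.ext hall)
  refine measure_mono_null ?_ (volume_setOf_apply_eq_apply hi)
  rintro x ⟨hσ, hτ⟩
  exact congrFun (Tuple.unique_monotone (f := x) hσ hτ) i

lemma volume_eq_sum_inter_sortedRegion {n : ℕ} {S : Set (Fin n → ℝ)}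
    (hS : ∀ σ : Equiv.Perm (Fin n), MeasurableSet (S ∩ sortedRegion σ)) :
    volume S = ∑ σ : Equiv.Perm (Fin n), volume (S ∩ sortedRegion σ) := by
  have hdisj : Pairwise (Function.onFun (AEDisjoint volume)
      fun σ : Equiv.Perm (Fin n) => S ∩ sortedRegion σ) := fun σ τ hστ =>
    (aedisjoint_sortedRegion hστ).mono Set.inter_subset_right Set.inter_subset_right
  have h := measure_iUnion₀ hdisj fun σ => (hS σ).nullMeasurableSet
  rwa [← Set.inter_iUnion, iUnion_sortedRegion, Set.inter_univ, tsum_fintype] at h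

/-- The event that the gaps with index in `J` are at least `ρ`. -/
def largeGaps (m : ℕ) (ρ : ℝ) (J : Finset (Fin m)) : Set (Fin (m + 1) → ℝ) :=
  {x ∈ unitBox (m + 1) | ∀ i ∈ J, ρ ≤ sortedCoords x i.succ - sortedCoords x i.castSucc}

lemma largeGaps_inter_sortedRegion (m : ℕ) (ρ : ℝ) (J : Finset (Fin m))
    (σ : Equiv.Perm (Fin (m + 1))) :
    largeGaps m ρ J ∩ sortedRegion σ =
      {x | (∀ i, x i ∈ Set.Icc (0 : ℝ) 1) ∧
        ∀ i ∈ J, ρ ≤ x (σ i.succ) - x (σ i.castSucc)} ∩ sortedRegion σ := by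
  ext x
  refine and_congr_left fun hx => ?_
  simp only [largeGaps, unitBox, Set.mem_ofPred_eq, Set.mem_univ_pi,
    sortedCoords_of_mem_sortedRegion hx, Function.comp_apply]

lemma measurableSet_largeGaps_inter_sortedRegion (m : ℕ) (ρ : ℝ) (J : Finset (Fin m))
    (σ : Equiv.Perm (Fin (m + 1))) : MeasurableSet (largeGaps m ρ J ∩ sortedRegion σ) := by
  rw [largeGaps_inter_sortedRegion]
  refine MeasurableSet.inter ?_ (measurableSet_sortedRegion σ)
  measurability

lemma measurableSet_largeGaps (m : ℕ) (ρ : ℝ) (J : Finset (Fin m)) :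
    MeasurableSet (largeGaps m ρ J) := by
  rw [← Set.inter_univ (largeGaps m ρ J), ← iUnion_sortedRegion, Set.inter_iUnion]
  exact MeasurableSet.iUnion fun σ => measurableSet_largeGaps_inter_sortedRegion m ρ J σ

/-- The total displacement of the `i`-th sorted point when every gap in `J` is widened by `ρ`. -/
def gapShift {m : ℕ} (ρ : ℝ) (J : Finset (Fin m)) (i : Fin (m + 1)) : ℝ :=
  ρ * ({j ∈ J | j.castSucc < i} : Finset (Fin m)).card

lemma gapShift_zero {m : ℕ} (ρ : ℝ) (J : Finset (Fin m)) : gapShift ρ J 0 = 0 := by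
  simp [gapShift]

lemma gapShift_last {m : ℕ} (ρ : ℝ) (J : Finset (Fin m)) :
    gapShift ρ J (Fin.last m) = ρ * J.card := by
  simp [gapShift, Fin.castSucc_lt_last]

lemma gapShift_succ {m : ℕ} (ρ : ℝ) (J : Finset (Fin m)) (i : Fin m) :
    gapShift ρ J i.succ = gapShift ρ J i.castSucc + if i ∈ J then ρ else 0 := by
  have hs : ({j ∈ J | j.castSucc < i.succ} : Finset (Fin m)) =
      {j ∈ J | j.castSucc < i.castSucc} ∪ if i ∈ J then {i} else ∅ := by
    ext j
    have hj : j.castSucc < i.succ ↔ j.castSucc < i.castSucc ∨ j = i := by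
      rw [Fin.castSucc_lt_succ_iff, Fin.castSucc_lt_castSucc_iff, le_iff_lt_or_eq]
    split_ifs with hi <;> simp only [Finset.mem_union, Finset.mem_filter, hj] <;> grind
  unfold gapShift
  rw [hs, Finset.card_union_of_disjoint (by split_ifs <;> simp)]
  split_ifs <;> simp [mul_add]

lemma monotone_add_gapShift_iff {m : ℕ} {ρ : ℝ} (hρ : 0 ≤ ρ) (J : Finset (Fin m))
    (z : Fin (m + 1) → ℝ) :
    ((∀ i, z i + gapShift ρ J i ∈ Set.Icc (0 : ℝ) 1) ∧
      (∀ i ∈ J, ρ ≤ z i.succ + gapShift ρ J i.succ - (z i.castSucc + gapShift ρ J i.castSucc)) ∧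
      Monotone (fun i => z i + gapShift ρ J i)) ↔
    (∀ i, z i ∈ Set.Icc 0 (1 - ρ * J.card)) ∧ Monotone z := by
  have hshift : Monotone (gapShift ρ J) := by
    rw [Fin.monotone_iff_le_succ]
    intro i
    rw [gapShift_succ]
    split_ifs <;> simp [hρ]
  have h0 := gapShift_zero ρ J
  have h1 := gapShift_last ρ J
  constructor
  · rintro ⟨hbox, hgap, hmono⟩
    have hz : Monotone z := by
      rw [Fin.monotone_iff_le_succ]
      intro i
      have hs := gapShift_succ ρ J i
      by_cases hi : i ∈ J
      · have := hgap i hi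
        simp only [hi, if_true] at hs
        linarith
      · have := hmono (Fin.castSucc_le_succ i)
        simp only [hi, if_false] at hs this
        linarith
    refine ⟨fun i => ⟨?_, ?_⟩, hz⟩
    · linarith [hz (Fin.zero_le i), (hbox 0).1]
    · linarith [hz (Fin.le_last i), (hbox (Fin.last m)).2]
  · rintro ⟨hbox, hz⟩
    refine ⟨fun i => ⟨?_, ?_⟩, fun i hi => ?_, hz.add hshift⟩
    · linarith [(hbox i).1, hshift (Fin.zero_le i)]
    · linarith [(hbox i).2, hshift (Fin.le_last i)]
    · have hs := gapShift_succ ρ J i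
      simp only [hi, if_true] at hs
      linarith [hz (Fin.castSucc_le_succ i)]

lemma volume_largeGaps_inter_sortedRegion {m : ℕ} {ρ : ℝ} (hρ : 0 ≤ ρ) (J : Finset (Fin m))
    (σ : Equiv.Perm (Fin (m + 1))) :
    volume (largeGaps m ρ J ∩ sortedRegion σ) =
      volume ((Set.univ.pi fun _ => Set.Icc 0 (1 - ρ * J.card)) ∩ sortedRegion σ) := by
  rw [← measure_preimage_add_right volume (fun i => gapShift ρ J (σ.symm i)),
    largeGaps_inter_sortedRegion]
  congr 1
  ext y
  have h := monotone_add_gapShift_iff hρ J (y ∘ σ)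
  have hall (p : Fin (m + 1) → Prop) : (∀ i, p i) ↔ ∀ i, p (σ i) :=
    ⟨fun hp i => hp _, fun hp i => by simpa using hp (σ.symm i)⟩
  simp only [Set.mem_preimage, Set.mem_inter_iff, Set.mem_ofPred_eq, Set.mem_univ_pi, sortedRegion]
  rw [hall, hall (fun i => y i ∈ _), and_assoc]
  convert! h using 4 <;> simp [Function.comp_def]

lemma volumeReal_largeGaps {m : ℕ} {ρ : ℝ} (hρ : 0 ≤ ρ) (J : Finset (Fin m)) :
    volume.real (largeGaps m ρ J) = max (1 - ρ * J.card) 0 ^ (m + 1) := by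
  have hv : volume (largeGaps m ρ J) = ENNReal.ofReal (1 - ρ * J.card) ^ (m + 1) := by
    rw [volume_eq_sum_inter_sortedRegion fun σ =>
      measurableSet_largeGaps_inter_sortedRegion m ρ J σ]
    simp_rw [volume_largeGaps_inter_sortedRegion hρ J]
    rw [← volume_eq_sum_inter_sortedRegion fun σ => (MeasurableSet.univ_pi fun _ =>
      measurableSet_Icc).inter (measurableSet_sortedRegion σ), volume_pi_pi]
    simp
  rw [measureReal_def, hv, ENNReal.toReal_pow, ENNReal.toReal_ofReal']

lemma sum_alternating_choose_mul_choose {N M k : ℕ} (hN : N ≤ M) :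
    ∑ j ∈ Finset.range (M + 1), (-1 : ℝ) ^ j * ((k + j).choose k) * (N.choose (k + j)) =
      if N = k then 1 else 0 := by
  have hterm (j : ℕ) : (-1 : ℝ) ^ j * ((k + j).choose k) * (N.choose (k + j)) =
      N.choose k * ((-1 : ℝ) ^ j * ((N - k).choose j)) := by
    have h := Nat.choose_mul (n := N) (k := k + j) (s := k) (Nat.le_add_right k j)
    rw [Nat.add_sub_cancel_left] at h
    have h' : (N.choose (k + j) : ℝ) * (k + j).choose k = N.choose k * (N - k).choose j := by
      exact_mod_cast h
    linear_combination (-1 : ℝ) ^ j * h'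
  simp_rw [hterm]
  rw [← Finset.mul_sum]
  rcases lt_or_ge N k with hlt | hge
  · simp [Nat.choose_eq_zero_of_lt hlt, hlt.ne]
  · have hsub : Finset.range (N - k + 1) ⊆ Finset.range (M + 1) :=
      Finset.range_subset_range.2 (by omega)
    rw [← Finset.sum_subset hsub fun j _ hj => by
      rw [Nat.choose_eq_zero_of_lt (by simpa using hj)]; simp]
    have h := Int.alternating_sum_range_choose (n := N - k)
    have h' : ∑ j ∈ Finset.range (N - k + 1), (-1 : ℝ) ^ j * ((N - k).choose j) =
        if N - k = 0 then 1 else 0 := by exact_mod_cast congrArg (Int.cast : ℤ → ℝ) h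
    rw [h']
    rcases hge.eq_or_lt with rfl | hlt
    · simp
    · rw [if_neg (by omega), if_neg (by omega), mul_zero]

/-- `C(k+j, k) C(m, k+j) (1 - (k+j)ρ)₊ ^ (m+1)` with the sign `(-1)^j`, the `j`-th term of the
inclusion-exclusion formula for the probability of exactly `k` large gaps. -/
noncomputable def gapTerm (m k : ℕ) (ρ : ℝ) (j : ℕ) : ℝ :=
  (-1 : ℝ) ^ j * ((k + j).choose k) *
    ((m.choose (k + j)) * max (1 - ρ * ((k + j : ℕ) : ℝ)) 0 ^ (m + 1))

lemma norm_gapTerm_le {m k : ℕ} {ρ C : ℝ}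
    (hC : m * Real.exp (-((m + 1) * ρ)) ≤ C)
    (j : ℕ) : ‖gapTerm m k ρ j‖ ≤ C ^ k / k.factorial * (C ^ j / j.factorial) := by
  have hbase : max (1 - ρ * ((k + j : ℕ) : ℝ)) 0 ≤ Real.exp (-(ρ * ((k + j : ℕ) : ℝ))) :=
    max_le (by linarith [Real.add_one_le_exp (-(ρ * ((k + j : ℕ) : ℝ)))]) (Real.exp_pos _).le
  have hpow : max (1 - ρ * ((k + j : ℕ) : ℝ)) 0 ^ (m + 1) ≤
      Real.exp (-((m + 1) * ρ)) ^ (k + j) := by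
    refine (pow_le_pow_left₀ (le_max_right _ _) hbase _).trans_eq ?_
    rw [← Real.exp_nat_mul, ← Real.exp_nat_mul]
    push_cast
    ring_nf
  have hchoose : ((k + j).choose k : ℝ) / (k + j).factorial =
      1 / (k.factorial * j.factorial) := by
    rw [Nat.cast_add_choose]
    have := Nat.factorial_ne_zero (k + j)
    field_simp
  calc ‖gapTerm m k ρ j‖
      = ((k + j).choose k) * ((m.choose (k + j)) * max (1 - ρ * ((k + j : ℕ) : ℝ)) 0 ^ (m + 1)) := by
        simp only [gapTerm, norm_mul, norm_pow, norm_neg, norm_one, one_pow, one_mul, norm_natCast,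
          Real.norm_of_nonneg (le_max_right _ (0 : ℝ))]
    _ ≤ ((k + j).choose k) * ((m : ℝ) ^ (k + j) / (k + j).factorial *
          Real.exp (-((m + 1) * ρ)) ^ (k + j)) := by
        gcongr
        exact Nat.choose_le_pow_div _ _
    _ = ((k + j).choose k : ℝ) / (k + j).factorial *
          (m * Real.exp (-((m + 1) * ρ))) ^ (k + j) := by
        rw [mul_pow]; ring
    _ ≤ ((k + j).choose k : ℝ) / (k + j).factorial * C ^ (k + j) := by
        gcongr
    _ = C ^ k / k.factorial * (C ^ j / j.factorial) := by
        rw [hchoose, pow_add]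
        field_simp

lemma tendsto_mul_exp_of_tendsto_sub_log {r : ℕ → ℝ} {η : ℝ}
    (h : Tendsto (fun m : ℕ => ((m : ℝ) + 1) * r m - Real.log ((m : ℝ) + 1)) atTop (nhds η)) :
    Tendsto (fun m : ℕ => (m : ℝ) * Real.exp (-((m + 1) * r m))) atTop
      (nhds (Real.exp (-η))) := by
  have h1 : Tendsto (fun m : ℕ => (m : ℝ) / (m + 1)) atTop (nhds 1) :=
    tendsto_natCast_div_add_atTop 1
  have h2 := h1.mul (h.neg.rexp)
  rw [one_mul] at h2
  refine h2.congr fun m => ?_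
  have hm : (0 : ℝ) < m + 1 := by positivity
  rw [neg_sub, sub_eq_add_neg, Real.exp_add, Real.exp_log hm]
  field_simp

lemma tendsto_mul_sq_zero {r : ℕ → ℝ} {η : ℝ}
    (h : Tendsto (fun m : ℕ => ((m : ℝ) + 1) * r m - Real.log ((m : ℝ) + 1)) atTop (nhds η)) :
    Tendsto (fun m : ℕ => ((m : ℝ) + 1) * r m ^ 2) atTop (nhds 0) := by
  have hcast : Tendsto (fun m : ℕ => (m : ℝ) + 1) atTop atTop :=
    tendsto_atTop_add_const_right _ _ tendsto_natCast_atTop_atTop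
  have hl2 := (Real.tendsto_pow_log_div_mul_add_atTop 1 0 2 one_ne_zero).comp hcast
  have hl1 := (Real.tendsto_pow_log_div_mul_add_atTop 1 0 1 one_ne_zero).comp hcast
  have hl0 := (Real.tendsto_pow_log_div_mul_add_atTop 1 0 0 one_ne_zero).comp hcast
  have hsum := (hl2.add ((h.mul hl1).const_mul 2)).add ((h.pow 2).mul hl0)
  simp only [mul_zero, add_zero] at hsum
  refine hsum.congr fun m => ?_
  have hm : (0 : ℝ) < m + 1 := by positivity
  simp only [Function.comp_apply, one_mul]
  field_simp
  ring

lemma tendsto_zero_of_tendsto_mul_sq {r : ℕ → ℝ}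
    (h : Tendsto (fun m : ℕ => ((m : ℝ) + 1) * r m ^ 2) atTop (nhds 0)) :
    Tendsto r atTop (nhds 0) := by
  have hsq : Tendsto (fun m => r m ^ 2) atTop (nhds 0) := by
    refine squeeze_zero (fun m => sq_nonneg _) (fun m => ?_) h
    nlinarith [sq_nonneg (r m), (Nat.cast_nonneg m : (0 : ℝ) ≤ m)]
  have habs := hsq.sqrt
  simp only [Real.sqrt_sq_eq_abs, Real.sqrt_zero] at habs
  exact (tendsto_zero_iff_abs_tendsto_zero r).2 habs

lemma tendsto_one_sub_mul_exp_pow {r : ℕ → ℝ}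
    (h : Tendsto (fun m : ℕ => ((m : ℝ) + 1) * r m ^ 2) atTop (nhds 0)) (a : ℝ) :
    Tendsto (fun m : ℕ => (max (1 - r m * a) 0 * Real.exp (r m * a)) ^ (m + 1)) atTop
      (nhds 1) := by
  have hr : ∀ᶠ m in atTop, |r m * a| < 1 := by
    have := ((tendsto_zero_of_tendsto_mul_sq h).mul_const a).abs
    rw [zero_mul, abs_zero] at this
    exact this.eventually_lt_const one_pos
  have hlow : Tendsto (fun m : ℕ => 1 - a ^ 2 * (((m : ℝ) + 1) * r m ^ 2)) atTop (nhds 1) := by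
    simpa using (h.const_mul (a ^ 2)).const_sub 1
  refine tendsto_of_tendsto_of_tendsto_of_le_of_le' hlow tendsto_const_nhds ?_ ?_
  · filter_upwards [hr] with m hm
    obtain ⟨hm1, hm2⟩ := abs_lt.1 hm
    have hbase : 1 + -(r m * a) ^ 2 ≤ max (1 - r m * a) 0 * Real.exp (r m * a) := by
      rw [max_eq_left (by linarith)]
      nlinarith [Real.add_one_le_exp (r m * a)]
    have hnn : 0 ≤ 1 + -(r m * a) ^ 2 := by nlinarith
    refine le_trans ?_ (pow_le_pow_left₀ hnn hbase (m + 1))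
    refine le_trans (le_of_eq ?_) (one_add_mul_le_pow (by linarith) (m + 1))
    push_cast
    ring
  · filter_upwards [hr] with m hm
    obtain ⟨hm1, hm2⟩ := abs_lt.1 hm
    refine pow_le_one₀ (by positivity) ?_
    rw [max_eq_left (by linarith)]
    calc (1 - r m * a) * Real.exp (r m * a)
        ≤ Real.exp (-(r m * a)) * Real.exp (r m * a) := by
          gcongr
          linarith [Real.add_one_le_exp (-(r m * a))]
      _ = 1 := by rw [← Real.exp_add]; simp

lemma tendsto_choose_mul_max_pow {r : ℕ → ℝ} {η : ℝ}
    (h : Tendsto (fun m : ℕ => ((m : ℝ) + 1) * r m - Real.log ((m : ℝ) + 1)) atTop (nhds η))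
    (a : ℕ) :
    Tendsto (fun m : ℕ => (m.choose a : ℝ) * max (1 - r m * a) 0 ^ (m + 1)) atTop
      (nhds (Real.exp (-η) ^ a / a.factorial)) := by
  have h1 := ProbabilityTheory.tendsto_choose_mul_pow_atTop a
    (tendsto_mul_exp_of_tendsto_sub_log h)
  have h2 := h1.mul (tendsto_one_sub_mul_exp_pow (tendsto_mul_sq_zero h) a)
  rw [mul_one] at h2
  refine h2.congr fun m => ?_
  have he : Real.exp (-((m + 1) * r m)) ^ a * Real.exp (r m * a) ^ (m + 1) = 1 := by
    rw [← Real.exp_nat_mul, ← Real.exp_nat_mul, ← Real.exp_add, Real.exp_eq_one_iff]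
    push_cast
    ring
  rw [mul_pow]
  linear_combination (m.choose a : ℝ) * max (1 - r m * a) 0 ^ (m + 1) * he

lemma tendsto_tsum_gapTerm {r : ℕ → ℝ} {η : ℝ}
    (h : Tendsto (fun m : ℕ => ((m : ℝ) + 1) * r m - Real.log ((m : ℝ) + 1)) atTop (nhds η))
    (k : ℕ) :
    Tendsto (fun m : ℕ => ∑' j, gapTerm m k (r m) j) atTop
      (nhds (Real.exp (-η * k) / k.factorial * Real.exp (-Real.exp (-η)))) := by
  set C := Real.exp (-η) + 1
  have hsum : ∑' j : ℕ, (-1 : ℝ) ^ j * ((k + j).choose k) *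
      (Real.exp (-η) ^ (k + j) / (k + j).factorial) =
      Real.exp (-η * k) / k.factorial * Real.exp (-Real.exp (-η)) := by
    have hexp : Real.exp (-Real.exp (-η)) = ∑' j : ℕ, (-Real.exp (-η)) ^ j / j.factorial := by
      generalize -Real.exp (-η) = t
      rw [Real.exp_eq_exp_ℝ, NormedSpace.exp_eq_tsum_div]
    rw [hexp, ← tsum_mul_left]
    refine tsum_congr fun j => ?_
    rw [Nat.cast_add_choose, mul_comm (-η), Real.exp_nat_mul, neg_pow (Real.exp (-η)) j, pow_add]
    have := Nat.factorial_ne_zero (k + j)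
    field_simp
  rw [← hsum]
  refine tendsto_tsum_of_dominated_convergence
    (bound := fun j => C ^ k / k.factorial * (C ^ j / j.factorial))
    ((Real.summable_pow_div_factorial C).mul_left _) (fun j => ?_) ?_
  · exact (tendsto_choose_mul_max_pow h (k + j)).const_mul _
  · filter_upwards [(tendsto_mul_exp_of_tendsto_sub_log h).eventually_le_const
      (lt_add_one (Real.exp (-η)))] with m hm j
    exact norm_gapTerm_le hm j

lemma circGap_castSucc {m : ℕ} (x : Fin (m + 1) → ℝ) (i : Fin m) :
    circGap x i.castSucc = sortedCoords x i.succ - sortedCoords x i.castSucc :=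
  dif_pos (by simp)

/-- The number of gaps between consecutive sorted coordinates that are at least `ρ`. -/
noncomputable def largeGapCount {m : ℕ} (ρ : ℝ) (x : Fin (m + 1) → ℝ) : ℕ :=
  ({i | ρ ≤ sortedCoords x i.succ - sortedCoords x i.castSucc} : Finset (Fin m)).card

lemma largeGapCount_le {m : ℕ} (ρ : ℝ) (x : Fin (m + 1) → ℝ) : largeGapCount ρ x ≤ m :=
  (Finset.card_le_univ _).trans_eq (Fintype.card_fin m)

lemma natCard_circGap_eq_largeGapCount {m : ℕ} (ρ : ℝ) (x : Fin (m + 1) → ℝ) :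
    Nat.card {i : Fin (m + 1) // (i : ℕ) + 1 < m + 1 ∧ ρ ≤ circGap x i} = largeGapCount ρ x := by
  rw [Nat.card_eq_fintype_card, Fintype.card_subtype, largeGapCount]
  refine (congrArg Finset.card ?_).trans (Finset.card_map Fin.castSuccEmb)
  ext i
  simp only [Finset.mem_filter_univ, Finset.mem_map, Fin.coe_castSuccEmb]
  constructor
  · rintro ⟨hi, hgap⟩
    refine ⟨⟨i, by omega⟩, ?_, rfl⟩
    rwa [← circGap_castSucc]
  · rintro ⟨j, hj, rfl⟩
    exact ⟨by simp, by rwa [circGap_castSucc]⟩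

lemma mem_discDB_iff {m k : ℕ} {ρ : ℝ} {x : Fin (m + 1) → ℝ} :
    x ∈ discDB (m + 1) ρ k ↔ x ∈ unitBox (m + 1) ∧ largeGapCount ρ x = k := by
  rw [← natCard_circGap_eq_largeGapCount]
  rfl

lemma sum_indicator_largeGaps {m : ℕ} (ρ : ℝ) (a : ℕ) {x : Fin (m + 1) → ℝ}
    (hx : x ∈ unitBox (m + 1)) :
    ∑ J ∈ Finset.powersetCard a (Finset.univ : Finset (Fin m)),
      (largeGaps m ρ J).indicator (fun _ => (1 : ℝ)) x = (largeGapCount ρ x).choose a := by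
  classical
  simp only [Set.indicator_apply]
  rw [Finset.sum_boole, largeGapCount, ← Finset.card_powersetCard]
  congr 2
  ext J
  simp only [largeGaps, Finset.mem_filter, Finset.mem_powersetCard, true_and,
    Set.mem_ofPred_eq, hx, Finset.subset_iff, Finset.mem_univ]
  tauto

lemma indicator_discDB (m k : ℕ) (ρ : ℝ) :
    (discDB (m + 1) ρ k).indicator (fun _ => (1 : ℝ)) = fun x =>
      ∑ j ∈ Finset.range (m + 1), (-1 : ℝ) ^ j * ((k + j).choose k) *
        ∑ J ∈ Finset.powersetCard (k + j) (Finset.univ : Finset (Fin m)),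
          (largeGaps m ρ J).indicator (fun _ => (1 : ℝ)) x := by
  classical
  ext x
  by_cases hx : x ∈ unitBox (m + 1)
  · simp_rw [sum_indicator_largeGaps ρ _ hx]
    rw [sum_alternating_choose_mul_choose (largeGapCount_le ρ x), Set.indicator_apply]
    simp only [mem_discDB_iff, hx, true_and]
  · have hlarge (J : Finset (Fin m)) : x ∉ largeGaps m ρ J := fun h => hx h.1
    have hdisc : x ∉ discDB (m + 1) ρ k := fun h => hx h.1
    simp [hlarge, hdisc]

lemma volume_unitBox (n : ℕ) : volume (unitBox n) = 1 := by
  rw [unitBox, volume_pi_pi]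
  simp

lemma measurableSet_discDB (m k : ℕ) (ρ : ℝ) : MeasurableSet (discDB (m + 1) ρ k) := by
  rw [← measurable_indicator_const_iff (1 : ℝ), indicator_discDB]
  refine Finset.measurable_sum _ fun j _ => Measurable.const_mul ?_ _
  exact Finset.measurable_sum _ fun J _ => measurable_const.indicator (measurableSet_largeGaps m ρ J)

lemma P_discDB_eq_tsum_gapTerm (m k : ℕ) {ρ : ℝ} (hρ : 0 ≤ ρ) :
    P_discDB (m + 1) ρ k = ∑' j, gapTerm m k ρ j := by
  have hint (J : Finset (Fin m)) :
      Integrable ((largeGaps m ρ J).indicator fun _ => (1 : ℝ)) volume := by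
    refine (integrable_indicator_iff (measurableSet_largeGaps m ρ J)).2 (integrableOn_const ?_)
    exact ((measure_mono fun x hx => hx.1).trans_lt
      ((volume_unitBox (m + 1)).trans_lt ENNReal.one_lt_top)).ne
  have hintegral : P_discDB (m + 1) ρ k =
      ∫ x, (discDB (m + 1) ρ k).indicator (fun _ => (1 : ℝ)) x :=
    (integral_indicator_one (measurableSet_discDB m k ρ)).symm
  rw [hintegral, indicator_discDB, integral_finsetSum _ fun j _ =>
    (integrable_finsetSum _ fun J _ => hint J).const_mul _]
  have hzero : ∀ j ∉ Finset.range (m + 1), gapTerm m k ρ j = 0 := by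
    intro j hj
    have hj' : m < k + j := by
      have := Finset.mem_range.not.1 hj
      omega
    simp [gapTerm, Nat.choose_eq_zero_of_lt hj']
  rw [tsum_eq_sum hzero]
  refine Finset.sum_congr rfl fun j _ => ?_
  rw [integral_const_mul, integral_finsetSum _ fun J _ => hint J, gapTerm]
  congr 1
  have hJ : ∀ J ∈ Finset.powersetCard (k + j) (Finset.univ : Finset (Fin m)),
      ∫ x, (largeGaps m ρ J).indicator (fun _ => (1 : ℝ)) x =
        max (1 - ρ * ((k + j : ℕ) : ℝ)) 0 ^ (m + 1) := by
    intro J hJ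
    rw [← (Finset.mem_powersetCard.1 hJ).2, ← volumeReal_largeGaps hρ J]
    exact integral_indicator_one (measurableSet_largeGaps m ρ J)
  rw [Finset.sum_congr rfl hJ, Finset.sum_const, Finset.card_powersetCard, Finset.card_fin,
    nsmul_eq_mul]

lemma connDB_eq_discDB_zero (n : ℕ) (ρ : ℝ) : connDB n ρ = discDB n ρ 0 := by
  ext x
  refine and_congr_right fun _ => ?_
  rw [Finite.card_eq_zero_iff, isEmpty_subtype]
  refine forall_congr' fun i => ?_
  rw [not_and, not_le]
  refine forall_congr' fun hi => ?_
  rw [circGap, dif_pos hi]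

/-- if `n·ρ_n − ln n → η`, then with disconnected boundary conditions the
probability of exactly `k` disconnections converges to the Poisson probability
`(e^{−ηk}/k!)·exp(−e^{−η})`; in particular the probability of connectedness converges
to `exp(−e^{−η})`. -/
theorem P_discDB_asymptotic (ρ : ℕ → ℝ) (hρ : ∀ n, 0 < ρ n) (η : ℝ)
    (h : Tendsto (fun n : ℕ => (n : ℝ) * ρ n - Real.log n) atTop (nhds η)) :
    (∀ k : ℕ, Tendsto (fun n : ℕ => P_discDB n (ρ n) k) atTop
      (nhds (Real.exp (-η * k) / (Nat.factorial k : ℝ) * Real.exp (-Real.exp (-η))))) ∧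
    Tendsto (fun n : ℕ => P_connDB n (ρ n)) atTop (nhds (Real.exp (-Real.exp (-η)))) := by
  have hdisc (k : ℕ) : Tendsto (fun n : ℕ => P_discDB n (ρ n) k) atTop
      (nhds (Real.exp (-η * k) / (Nat.factorial k : ℝ) * Real.exp (-Real.exp (-η)))) := by
    rw [← tendsto_add_atTop_iff_nat 1]
    have hshift := (tendsto_add_atTop_iff_nat 1).2 h
    push_cast at hshift
    refine (tendsto_tsum_gapTerm hshift k).congr fun m => ?_
    exact (P_discDB_eq_tsum_gapTerm m k (hρ (m + 1)).le).symm
  refine ⟨hdisc, ?_⟩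
  have h0 := hdisc 0
  simp only [Nat.cast_zero, mul_zero, Real.exp_zero, Nat.factorial_zero, Nat.cast_one, div_one,
    one_mul] at h0
  simpa only [P_connDB, P_discDB, connDB_eq_discDB_zero] using h0
end

section
/- Let (ρ_n) be a sequence of positive reals such that n·ρ_n − ln n → −∞ as n → ∞. Then the probability of connectedness of the 1-dimensional MANET with disconnected boundary conditions satisfies P_{CONN-DB}(n, ρ_n) → 0 as n → ∞. -/
open MeasureTheory Filter

open Set in
/-- The event that the `i`-th node lies in `(-∞, 1 - ρ]` and no other node lies within
distance `< ρ` to its right. -/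
def rightIsolated {n : ℕ} (ρ : ℝ) (i : Fin n) : Set (Fin n → ℝ) :=
  {x | x i ≤ 1 - ρ ∧ ∀ j, j ≠ i → x j ∉ Ico (x i) (x i + ρ)}

lemma measurableSet_rightIsolated {n : ℕ} (ρ : ℝ) (i : Fin n) :
    MeasurableSet (rightIsolated ρ i) := by
  unfold rightIsolated
  simp only [Set.mem_Ico]
  measurability

/-- In a connected configuration at most one node is right isolated. -/
lemma eq_of_mem_rightIsolated {n : ℕ} {ρ : ℝ} {x : Fin n → ℝ} (hx : x ∈ connDB n ρ)
    {i j : Fin n} (hi : x ∈ rightIsolated ρ i) (hj : x ∈ rightIsolated ρ j) : i = j := by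
  have last (k : Fin n) (hk : x ∈ rightIsolated ρ (Tuple.sort x k)) : (k : ℕ) + 1 = n := by
    by_contra hne
    have hlt : (k : ℕ) + 1 < n := by omega
    refine hk.2 (Tuple.sort x ⟨k + 1, hlt⟩) ?_ ⟨?_, ?_⟩
    · intro h
      simpa [Fin.ext_iff] using (Tuple.sort x).injective h
    · exact Tuple.monotone_sort x (Fin.le_def.2 (Nat.le_succ _))
    · have := hx.2 k hlt
      simp only [sortedCoords] at this
      linarith
  obtain ⟨k, rfl⟩ := (Tuple.sort x).surjective i
  obtain ⟨l, rfl⟩ := (Tuple.sort x).surjective j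
  have hk := last k hi
  have hl := last l hj
  congr 1
  ext
  omega

/-- The uniform distribution on `[0,1]`. -/
noncomputable abbrev unitUniform : Measure ℝ := volume.restrict (Set.Icc 0 1)

instance : IsProbabilityMeasure unitUniform := ⟨by simp⟩

lemma P_connDB_eq (n : ℕ) (ρ : ℝ) :
    P_connDB n ρ = (Measure.pi fun _ : Fin n => unitUniform).real (connDB n ρ) := by
  have hbox : MeasurableSet (unitBox n) := MeasurableSet.univ_pi fun _ => measurableSet_Icc
  rw [P_connDB, ← measureReal_def, ← Measure.restrict_pi_pi]
  change _ = (volume.restrict (unitBox n)).real _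
  rw [measureReal_restrict_apply' hbox, Set.inter_eq_left.2 fun x hx => hx.1]

lemma unitUniform_compl_Ico {ρ t : ℝ} (hρ : 0 ≤ ρ) (h0 : 0 ≤ t) (h1 : t ≤ 1 - ρ) :
    unitUniform (Set.Ico t (t + ρ))ᶜ = ENNReal.ofReal (1 - ρ) := by
  have hsub : Set.Ico t (t + ρ) ∩ Set.Icc 0 1 = Set.Ico t (t + ρ) :=
    Set.inter_eq_left.2 fun x hx => ⟨h0.trans hx.1, by linarith [hx.2]⟩
  rw [prob_compl_eq_one_sub measurableSet_Ico, Measure.restrict_apply measurableSet_Ico, hsub,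
    Real.volume_Ico, add_sub_cancel_left, ENNReal.ofReal_sub _ hρ, ENNReal.ofReal_one]

lemma unitUniform_compl_Ico_union_Ico {ρ s t : ℝ} (hρ : 0 ≤ ρ) (hs0 : 0 ≤ s) (hs1 : s ≤ 1 - ρ)
    (ht0 : 0 ≤ t) (ht1 : t ≤ 1 - ρ) (hst : t ∉ Set.Ico s (s + ρ)) (hts : s ∉ Set.Ico t (t + ρ)) :
    unitUniform (Set.Ico s (s + ρ) ∪ Set.Ico t (t + ρ))ᶜ = ENNReal.ofReal (1 - 2 * ρ) := by
  have hsub : (Set.Ico s (s + ρ) ∪ Set.Ico t (t + ρ)) ∩ Set.Icc 0 1 =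
      Set.Ico s (s + ρ) ∪ Set.Ico t (t + ρ) := by
    refine Set.inter_eq_left.2 ?_
    rintro x (hx | hx)
    · exact ⟨hs0.trans hx.1, by linarith [hx.2]⟩
    · exact ⟨ht0.trans hx.1, by linarith [hx.2]⟩
  have hdisj : Disjoint (Set.Ico s (s + ρ)) (Set.Ico t (t + ρ)) := by
    rw [Set.disjoint_left]
    intro x hx hx'
    simp only [Set.mem_Ico, not_and, not_lt] at *
    rcases le_total s t with h | h
    · linarith [hst h]
    · linarith [hts h]
  rw [prob_compl_eq_one_sub (measurableSet_Ico.union measurableSet_Ico),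
    Measure.restrict_apply (measurableSet_Ico.union measurableSet_Ico), hsub,
    measure_union hdisj measurableSet_Ico, Real.volume_Ico, Real.volume_Ico, add_sub_cancel_left,
    add_sub_cancel_left, ← ENNReal.ofReal_add hρ hρ, ← two_mul,
    ENNReal.ofReal_sub _ (by positivity), ENNReal.ofReal_one]

/-- Conditioning on the `i`-th coordinate of a uniform point of the cube. -/
lemma pi_unitUniform_eq_lintegral {n : ℕ} (i : Fin (n + 1)) {S : Set (Fin (n + 1) → ℝ)}
    (hS : MeasurableSet S) :
    (Measure.pi fun _ => unitUniform) S =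
      ∫⁻ t in Set.Icc (0 : ℝ) 1, (Measure.pi fun _ => unitUniform) {y | i.insertNth t y ∈ S} := by
  have hmp := (measurePreserving_piFinSuccAbove (fun _ : Fin (n + 1) => unitUniform) i).symm
  rw [← hmp.measure_preimage_equiv, Measure.prod_apply
    ((MeasurableEquiv.piFinSuccAbove (fun _ => ℝ) i).symm.measurable hS)]
  rfl

lemma pi_unitUniform_rightIsolated {n : ℕ} {ρ : ℝ} (hρ : 0 ≤ ρ) (hρ1 : ρ ≤ 1) (i : Fin n) :
    (Measure.pi fun _ => unitUniform).real (rightIsolated ρ i) = (1 - ρ) ^ n := by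
  obtain _ | n := n
  · exact i.elim0
  have key : ∀ t ∈ Set.Icc (0 : ℝ) 1,
      (Measure.pi fun _ => unitUniform) {y : Fin n → ℝ | i.insertNth t y ∈ rightIsolated ρ i} =
      (Set.Iic (1 - ρ)).indicator (fun _ => ENNReal.ofReal (1 - ρ) ^ n) t := by
    intro t ht
    by_cases h : t ≤ 1 - ρ
    · have : {y : Fin n → ℝ | i.insertNth t y ∈ rightIsolated ρ i} =
          Set.univ.pi fun _ => (Set.Ico t (t + ρ))ᶜ := by
        ext y
        simp [rightIsolated, h, Fin.forall_iff_succAbove i]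
      rw [this, Measure.pi_pi]
      simp [unitUniform_compl_Ico hρ ht.1 h, h]
    · simp [rightIsolated, h]
  have hset : Set.Iic (1 - ρ) ∩ Set.Icc 0 1 = Set.Icc 0 (1 - ρ) := by
    ext t
    simp only [Set.mem_inter_iff, Set.mem_Iic, Set.mem_Icc]
    constructor
    · tauto
    · rintro ⟨h0, h1⟩
      exact ⟨h1, h0, by linarith⟩
  rw [measureReal_def, pi_unitUniform_eq_lintegral i (measurableSet_rightIsolated ρ i),
    setLIntegral_congr_fun measurableSet_Icc key, lintegral_indicator_const measurableSet_Iic,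
    Measure.restrict_apply measurableSet_Iic, hset, Real.volume_Icc, sub_zero, ← pow_succ,
    ENNReal.toReal_pow, ENNReal.toReal_ofReal (by linarith)]

lemma pi_unitUniform_le_of_forall {n : ℕ} (i : Fin (n + 1)) {S : Set (Fin (n + 1) → ℝ)}
    (hS : MeasurableSet S) {c : ENNReal}
    (h : ∀ t ∈ Set.Icc (0 : ℝ) 1,
      (Measure.pi fun _ => unitUniform) {y | i.insertNth t y ∈ S} ≤ c) :
    (Measure.pi fun _ => unitUniform) S ≤ c := by
  rw [pi_unitUniform_eq_lintegral i hS]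
  refine (setLIntegral_mono measurable_const h).trans ?_
  simp

lemma pi_unitUniform_rightIsolated_inter_le {n : ℕ} {ρ : ℝ} (hρ : 0 ≤ ρ) (hρ1 : 2 * ρ ≤ 1)
    {i j : Fin n} (hij : i ≠ j) :
    (Measure.pi fun _ => unitUniform).real (rightIsolated ρ i ∩ rightIsolated ρ j) ≤
      (1 - 2 * ρ) ^ (n - 2) := by
  obtain _ | _ | n := n
  · exact i.elim0
  · exact absurd (Fin.ext (by omega)) hij
  obtain ⟨k, rfl⟩ := Fin.exists_succAbove_eq hij.symm
  have hS := (measurableSet_rightIsolated ρ i).inter (measurableSet_rightIsolated ρ (i.succAbove k))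
  refine ENNReal.toReal_le_of_le_ofReal (pow_nonneg (by linarith) _) ?_
  rw [ENNReal.ofReal_pow (by linarith)]
  refine pi_unitUniform_le_of_forall i hS fun s hs => ?_
  refine pi_unitUniform_le_of_forall k ?_ fun t ht => ?_
  · exact ((MeasurableEquiv.piFinSuccAbove (fun _ => ℝ) i).symm.measurable.comp
      measurable_prodMk_left) hS
  by_cases h : s ≤ 1 - ρ ∧ t ≤ 1 - ρ ∧ t ∉ Set.Ico s (s + ρ) ∧ s ∉ Set.Ico t (t + ρ)
  · obtain ⟨hs1, ht1, hst, hts⟩ := h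
    calc _ ≤ (Measure.pi fun _ => unitUniform) (Set.univ.pi fun _ : Fin n =>
          (Set.Ico s (s + ρ) ∪ Set.Ico t (t + ρ))ᶜ) := by
          refine measure_mono fun y hy l _ => ?_
          obtain ⟨⟨-, h1⟩, -, h2⟩ := hy
          have h1 := h1 (i.succAbove (k.succAbove l)) (Fin.succAbove_ne _ _)
          have h2 := h2 (i.succAbove (k.succAbove l))
            (fun h => Fin.succAbove_ne _ _ (Fin.succAbove_right_injective h))
          simp only [Fin.insertNth_apply_same, Fin.insertNth_apply_succAbove] at h1 h2
          rintro (h | h)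
          · exact h1 h
          · exact h2 h
      _ = _ := by
          rw [Measure.pi_pi, unitUniform_compl_Ico_union_Ico hρ hs.1 hs1 ht.1 ht1 hst hts]
          simp
  · refine le_of_eq_of_le ((congrArg _ (Set.eq_empty_of_forall_notMem fun y hy => h ?_)).trans
      measure_empty) zero_le
    obtain ⟨⟨h1, h2⟩, h3, h4⟩ := hy
    have h2 := h2 (i.succAbove k) (Fin.succAbove_ne _ _)
    have h4 := h4 i (Fin.succAbove_ne _ _).symm
    simp only [Fin.insertNth_apply_same, Fin.insertNth_apply_succAbove] at h1 h2 h3 h4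
    exact ⟨h1, h3, h2, h4⟩

/-- Second moment method: a set on which at most one of `n` events of probability `p` occurs is
unlikely when the expected number `n * p` is large and the events are almost uncorrelated. -/
lemma sq_mul_measureReal_le_of_pairwise {Ω : Type*} [MeasurableSpace Ω] (μ : Measure Ω)
    [IsProbabilityMeasure μ] {n : ℕ} {B : Fin n → Set Ω} (hB : ∀ i, MeasurableSet (B i))
    {p q : ℝ} (hq : 0 ≤ q) (hp : ∀ i, μ.real (B i) = p)
    (hpq : ∀ i j, i ≠ j → μ.real (B i ∩ B j) ≤ q) (hnp : 1 ≤ n * p) {C : Set Ω}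
    (hC : ∀ x ∈ C, ∀ i j, x ∈ B i → x ∈ B j → i = j) :
    (n * p - 1) ^ 2 * μ.real C ≤ n * p + n ^ 2 * q - (n * p) ^ 2 := by
  classical
  set m : ℝ := n * p with hm
  let N : Ω → ℝ := fun x => ∑ i, (B i).indicator 1 x
  have hind (S : Set Ω) (hS : MeasurableSet S) : Integrable (S.indicator (1 : Ω → ℝ)) μ :=
    (integrable_const (1 : ℝ)).indicator hS
  have hNint : Integrable N μ := integrable_finsetSum _ fun i _ => hind _ (hB i)
  have hsq (x : Ω) : (N x - m) ^ 2 =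
      (∑ i, ∑ j, (B i ∩ B j).indicator 1 x) - 2 * m * N x + m ^ 2 := by
    have : (∑ i, ∑ j, (B i ∩ B j).indicator (1 : Ω → ℝ) x) = N x * N x := by
      simp only [N, Finset.sum_mul_sum, Set.inter_indicator_one, Pi.mul_apply]
    rw [this]
    ring
  have hdint : Integrable (fun x => ∑ i, ∑ j, (B i ∩ B j).indicator (1 : Ω → ℝ) x) μ :=
    integrable_finsetSum _ fun i _ => integrable_finsetSum _ fun j _ =>
      hind _ ((hB i).inter (hB j))
  have hsqint : Integrable (fun x => (N x - m) ^ 2) μ := by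
    simp only [hsq]
    exact (hdint.sub (hNint.const_mul _)).add (integrable_const _)
  have hEN : ∫ x, N x ∂μ = m := by
    simp only [N]
    rw [integral_finsetSum _ fun i _ => hind _ (hB i)]
    simp [integral_indicator_one, hB, hp, hm]
  have hpair (i j : Fin n) : μ.real (B i ∩ B j) ≤ (if i = j then p else 0) + q := by
    split_ifs with h
    · subst h
      simp [hp, hq]
    · simpa using hpq i j h
  have hE : ∫ x, (N x - m) ^ 2 ∂μ ≤ m + n ^ 2 * q - m ^ 2 := by
    simp only [hsq]
    rw [integral_add (by exact hdint.sub (hNint.const_mul _)) (integrable_const _),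
      integral_sub hdint (hNint.const_mul _), integral_const_mul, hEN,
      integral_finsetSum _ fun i _ => integrable_finsetSum _ fun j _ =>
        hind _ ((hB i).inter (hB j))]
    have : ∑ i, ∫ x, ∑ j, (B i ∩ B j).indicator (1 : Ω → ℝ) x ∂μ ≤ m + n ^ 2 * q := by
      calc _ = ∑ i, ∑ j, μ.real (B i ∩ B j) := by
            refine Finset.sum_congr rfl fun i _ => ?_
            rw [integral_finsetSum _ fun j _ => hind _ ((hB i).inter (hB j))]
            exact Finset.sum_congr rfl fun j _ => integral_indicator_one ((hB i).inter (hB j))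
        _ ≤ ∑ i : Fin n, ∑ j : Fin n, ((if i = j then p else 0) + q) :=
            Finset.sum_le_sum fun i _ => Finset.sum_le_sum fun j _ => hpair i j
        _ = m + n ^ 2 * q := by
            simp [Finset.sum_add_distrib, hm]
            ring
    simp only [integral_const, probReal_univ, one_smul]
    linarith
  refine le_trans ?_ ((mul_meas_ge_le_integral_of_nonneg
    (Eventually.of_forall fun x => sq_nonneg (N x - m)) hsqint ((m - 1) ^ 2)).trans hE)
  refine mul_le_mul_of_nonneg_left (measureReal_mono fun x hx => ?_) (sq_nonneg _)
  have hN : N x ≤ 1 := by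
    have : N x = ((Finset.univ.filter fun i => x ∈ B i).card : ℝ) := by
      simp [N, Set.indicator_apply]
    rw [this]
    exact_mod_cast Finset.card_le_one.2 fun i hi j hj =>
      hC x hx i j (by simpa using hi) (by simpa using hj)
  simp only [Set.mem_ofPred_eq]
  nlinarith

lemma P_connDB_le {n : ℕ} {ρ : ℝ} (hn : 2 ≤ n) (hρ : 0 ≤ ρ) (hρ1 : 2 * ρ ≤ 1)
    (hm : 2 ≤ n * (1 - ρ) ^ n) :
    P_connDB n ρ ≤ 4 * (n * (1 - ρ) ^ n)⁻¹ + 4 * (((1 - ρ) ^ 4)⁻¹ - 1) := by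
  have hpos : 0 < 1 - ρ := by linarith
  have hmain := sq_mul_measureReal_le_of_pairwise (Measure.pi fun _ : Fin n => unitUniform)
    (measurableSet_rightIsolated ρ) (q := (1 - 2 * ρ) ^ (n - 2)) (pow_nonneg (by linarith) _)
    (pi_unitUniform_rightIsolated hρ (by linarith))
    (fun i j hij => pi_unitUniform_rightIsolated_inter_le hρ hρ1 hij) (by linarith)
    (fun x hx i j => eq_of_mem_rightIsolated (n := n) (ρ := ρ) (x := x) hx)
  rw [← P_connDB_eq] at hmain
  have hq : (1 - 2 * ρ) ^ (n - 2) ≤ ((1 - ρ) ^ n) ^ 2 * ((1 - ρ) ^ 4)⁻¹ := by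
    obtain ⟨k, rfl⟩ := Nat.exists_eq_add_of_le hn
    calc (1 - 2 * ρ) ^ (2 + k - 2) ≤ ((1 - ρ) ^ 2) ^ (2 + k - 2) :=
          pow_le_pow_left₀ (by linarith) (by nlinarith) _
      _ = _ := by
          rw [Nat.add_sub_cancel_left, ← pow_mul]
          field_simp
          ring
  set m : ℝ := n * (1 - ρ) ^ n with hmdef
  set r : ℝ := ((1 - ρ) ^ 4)⁻¹
  have hq' : (n : ℝ) ^ 2 * (1 - 2 * ρ) ^ (n - 2) ≤ m ^ 2 * r := by
    calc _ ≤ (n : ℝ) ^ 2 * (((1 - ρ) ^ n) ^ 2 * r) := by gcongr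
      _ = m ^ 2 * r := by rw [hmdef]; ring
  have hP : 0 ≤ P_connDB n ρ := ENNReal.toReal_nonneg
  have hquad : (m / 2) ^ 2 * P_connDB n ρ ≤ m + m ^ 2 * (r - 1) := by
    have : (m / 2) ^ 2 * P_connDB n ρ ≤ (m - 1) ^ 2 * P_connDB n ρ := by
      gcongr
      linarith
    linarith
  have hm0 : 0 < m := by linarith
  calc P_connDB n ρ = ((m / 2) ^ 2)⁻¹ * ((m / 2) ^ 2 * P_connDB n ρ) := by field_simp
    _ ≤ ((m / 2) ^ 2)⁻¹ * (m + m ^ 2 * (r - 1)) := by gcongr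
    _ = _ := by
      field_simp
      ring

lemma exp_neg_le_mul_one_sub_pow {n : ℕ} {ρ : ℝ} (hn : 0 < n) (hρ1 : 2 * ρ ≤ 1) :
    Real.exp (-(n * ρ - Real.log n) - 2 * (n * ρ ^ 2)) ≤ n * (1 - ρ) ^ n := by
  have hpos : 0 < 1 - ρ := by linarith
  have hn' : (0 : ℝ) < n := by exact_mod_cast hn
  have hlog : -ρ - 2 * ρ ^ 2 ≤ Real.log (1 - ρ) := by
    refine le_trans ?_ (Real.one_sub_inv_le_log_of_pos hpos)
    have : 1 - (1 - ρ)⁻¹ = -ρ / (1 - ρ) := by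
      field_simp
      ring
    rw [this, le_div_iff₀ hpos]
    nlinarith [mul_nonneg (sq_nonneg ρ) (sub_nonneg.2 hρ1)]
  rw [← Real.le_log_iff_exp_le (by positivity), Real.log_mul hn'.ne' (by positivity), Real.log_pow]
  nlinarith [mul_le_mul_of_nonneg_left hlog hn'.le]

/-- if `n·ρ_n − ln n → −∞`, then the probability of connectedness with
disconnected boundary conditions tends to `0`. -/
theorem P_connDB_tendsto_zero (ρ : ℕ → ℝ) (hρ : ∀ n, 0 < ρ n)
    (h : Tendsto (fun n : ℕ => (n : ℝ) * ρ n - Real.log n) atTop atBot) :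
    Tendsto (fun n : ℕ => P_connDB n (ρ n)) atTop (nhds 0) := by
  have hlog (k : ℕ) : Tendsto (fun n : ℕ => Real.log n ^ k / n) atTop (nhds 0) := by
    have := (Real.isLittleO_pow_log_id_atTop (n := k)).tendsto_div_nhds_zero
    exact this.comp tendsto_natCast_atTop_atTop
  have hle : ∀ᶠ n : ℕ in atTop, ρ n ≤ Real.log n / n := by
    filter_upwards [h.eventually_le_atBot 0, eventually_gt_atTop 0] with n hn hn0
    rw [le_div_iff₀ (by exact_mod_cast hn0)]
    linarith
  have hρ0 : Tendsto ρ atTop (nhds 0) :=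
    squeeze_zero' (Eventually.of_forall fun n => (hρ n).le) hle (by simpa using hlog 1)
  have hhalf : ∀ᶠ n : ℕ in atTop, 2 * ρ n ≤ 1 := by
    filter_upwards [hρ0.eventually_le_const (show (0 : ℝ) < 1 / 2 by norm_num)] with n hn
    linarith
  have hexp : ∀ᶠ n : ℕ in atTop,
      Real.exp (-(n * ρ n - Real.log n) - 2) ≤ n * (1 - ρ n) ^ n := by
    filter_upwards [hhalf, hle, eventually_gt_atTop 0,
      (hlog 2).eventually_le_const zero_lt_one] with n h1 h2 h3 h4
    refine le_trans (Real.exp_le_exp.2 ?_) (exp_neg_le_mul_one_sub_pow h3 h1)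
    have h3' : (0 : ℝ) < n := by exact_mod_cast h3
    have : n * ρ n ^ 2 ≤ Real.log n ^ 2 / n := by
      calc n * ρ n ^ 2 ≤ n * (Real.log n / n) ^ 2 := by
            gcongr
            exact (hρ n).le
        _ = _ := by field_simp
    linarith
  have hm : Tendsto (fun n : ℕ => n * (1 - ρ n) ^ n) atTop atTop :=
    tendsto_atTop_mono' _ hexp <| Real.tendsto_exp_atTop.comp <|
      tendsto_atTop_add_const_right _ (-2) (tendsto_neg_atBot_atTop.comp h)
  have hlim : Tendsto (fun n : ℕ => 4 * (n * (1 - ρ n) ^ n)⁻¹ + 4 * (((1 - ρ n) ^ 4)⁻¹ - 1))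
      atTop (nhds 0) := by
    have h1 := (tendsto_inv_atTop_zero.comp hm).const_mul 4
    have h2 := (((((hρ0.const_sub 1).pow 4).inv₀ (by norm_num)).sub_const 1).const_mul 4)
    simpa using h1.add h2
  refine squeeze_zero' (Eventually.of_forall fun n => ENNReal.toReal_nonneg) ?_ hlim
  filter_upwards [hhalf, eventually_ge_atTop 2, hm.eventually_ge_atTop 2] with n h1 h2 h3
  exact P_connDB_le h2 (hρ n).le h1 h3
end

section
/- Consider the 1-dimensional MANET with disconnected boundary conditions, with n nodes uniformly distributed on [0,ℓ(n)] and radio range r(n) > 0, ℓ(n) > 0, and let ρ_n = r(n)/ℓ(n). Suppose there are ε > 0 and N such that n·r(n) ≥ (1+ε)·ℓ(n)·ln n for all n ≥ N. Then the probability of connectedness satisfies P_{CONN-DB}(n, ρ_n) → 1 as n → ∞. -/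
open MeasureTheory Filter

/-- The configurations in the unit cube in which node `i` lies in `[0, 1 - ρ]` and no other node
lies in the open interval of length `ρ` to its right. -/
def emptyRightOf {n : ℕ} (ρ : ℝ) (i : Fin n) : Set (Fin n → ℝ) :=
  {x | x i ∈ Set.Icc 0 (1 - ρ) ∧ ∀ j, j ≠ i → x j ∈ Set.Icc 0 1 \ Set.Ioo (x i) (x i + ρ)}

lemma unitBox_subset_connDB_union (n : ℕ) (ρ : ℝ) :
    unitBox n ⊆ connDB n ρ ∪ ⋃ i, emptyRightOf ρ i := by
  intro x hx
  by_cases hc : x ∈ connDB n ρ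
  · exact Or.inl hc
  refine Or.inr (Set.mem_iUnion.2 ?_)
  simp only [connDB, Set.mem_ofPred_eq, hx, true_and, not_forall, not_lt] at hc
  obtain ⟨i, hi, hgap⟩ := hc
  have hbox : ∀ j, 0 ≤ x j ∧ x j ≤ 1 := fun j => hx j (Set.mem_univ j)
  have hmono : Monotone (sortedCoords x) := Tuple.monotone_sort x
  have hnext : sortedCoords x ⟨i + 1, hi⟩ ≤ 1 := (hbox _).2
  refine ⟨Tuple.sort x i, ⟨(hbox _).1, ?_⟩, fun j _ => ⟨hbox j, ?_⟩⟩
  · change sortedCoords x i ≤ 1 - ρ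
    linarith
  · rintro ⟨h₁, h₂⟩
    change sortedCoords x i < x j at h₁
    change x j < sortedCoords x i + ρ at h₂
    have hj : x j = sortedCoords x ((Tuple.sort x).symm j) := by simp [sortedCoords]
    rw [hj] at h₁ h₂
    have hlt : i < (Tuple.sort x).symm j := hmono.reflect_lt h₁
    have hle : (⟨i + 1, hi⟩ : Fin n) ≤ (Tuple.sort x).symm j := Nat.succ_le_of_lt hlt
    linarith [hmono hle]

lemma volume_Icc_diff_Ioo {ρ a : ℝ} (ha : a ∈ Set.Icc 0 (1 - ρ)) (hρ : 0 < ρ) :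
    volume (Set.Icc (0 : ℝ) 1 \ Set.Ioo a (a + ρ)) = ENNReal.ofReal (1 - ρ) := by
  have hsub : Set.Ioo a (a + ρ) ⊆ Set.Icc (0 : ℝ) 1 := fun t ht =>
    ⟨ha.1.trans ht.1.le, by linarith [ht.2, ha.2]⟩
  rw [measure_sdiff hsub measurableSet_Ioo.nullMeasurableSet (by simp), Real.volume_Icc,
    Real.volume_Ioo, ← ENNReal.ofReal_sub _ (by linarith)]
  congr 1
  ring

lemma volume_emptyRightOf_le {m : ℕ} {ρ : ℝ} (hρ : 0 < ρ) (i : Fin (m + 1)) :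
    volume (emptyRightOf ρ i) ≤ ENNReal.ofReal (1 - ρ) ^ (m + 1) := by
  let S : Set (ℝ × (Fin m → ℝ)) :=
    {p | p.1 ∈ Set.Icc 0 (1 - ρ) ∧ ∀ j, p.2 j ∈ Set.Icc 0 1 \ Set.Ioo p.1 (p.1 + ρ)}
  have hS : MeasurableSet S := by
    simp only [S, Set.mem_sdiff, Set.mem_Icc, Set.mem_Ioo]
    measurability
  have hpre : emptyRightOf ρ i = MeasurableEquiv.piFinSuccAbove (fun _ => ℝ) i ⁻¹' S := by
    ext x
    refine and_congr Iff.rfl ⟨fun h j => h _ (Fin.succAbove_ne i j), fun h j hj => ?_⟩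
    obtain ⟨k, rfl⟩ := Fin.exists_succAbove_eq hj
    exact h k
  rw [hpre, (volume_preserving_piFinSuccAbove (fun _ => ℝ) i).measure_preimage
    hS.nullMeasurableSet, Measure.volume_eq_prod, Measure.prod_apply hS]
  calc ∫⁻ a, volume (Prod.mk a ⁻¹' S)
      ≤ ∫⁻ a, (Set.Icc 0 (1 - ρ)).indicator (fun _ => ENNReal.ofReal (1 - ρ) ^ m) a := by
        refine lintegral_mono fun a => ?_
        by_cases ha : a ∈ Set.Icc 0 (1 - ρ)
        · have hfib : Prod.mk a ⁻¹' S
              = Set.univ.pi fun _ : Fin m => Set.Icc (0 : ℝ) 1 \ Set.Ioo a (a + ρ) := by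
            ext y
            exact ⟨fun h j _ => h.2 j, fun h => ⟨ha, fun j => h j (Set.mem_univ j)⟩⟩
          rw [Set.indicator_of_mem ha, hfib, volume_pi_pi]
          simp [volume_Icc_diff_Ioo ha hρ]
        · have hfib : Prod.mk a ⁻¹' S = ∅ := Set.eq_empty_of_forall_notMem fun y h => ha h.1
          simp [hfib]
    _ = ENNReal.ofReal (1 - ρ) ^ (m + 1) := by
        rw [lintegral_indicator_const measurableSet_Icc, Real.volume_Icc, sub_zero, pow_succ]

lemma volume_connDB_le_one (n : ℕ) (ρ : ℝ) : volume (connDB n ρ) ≤ 1 :=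
  (measure_mono fun _ hx => hx.1).trans_eq (volume_unitBox n)

lemma P_connDB_le_one (n : ℕ) (ρ : ℝ) : P_connDB n ρ ≤ 1 :=
  ENNReal.toReal_mono ENNReal.one_ne_top (volume_connDB_le_one n ρ)

lemma one_sub_le_P_connDB {n : ℕ} (hn : n ≠ 0) {ρ : ℝ} (hρ : 0 < ρ) :
    1 - n * Real.exp (-(n * ρ)) ≤ P_connDB n ρ := by
  obtain ⟨m, rfl⟩ := Nat.exists_eq_succ_of_ne_zero hn
  have hbad : ∀ i : Fin (m + 1),
      volume (emptyRightOf ρ i) ≤ ENNReal.ofReal (Real.exp (-((m + 1 : ℕ) * ρ))) := fun i =>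
    calc volume (emptyRightOf ρ i) ≤ ENNReal.ofReal (1 - ρ) ^ (m + 1) :=
          volume_emptyRightOf_le hρ i
      _ ≤ ENNReal.ofReal (Real.exp (-ρ)) ^ (m + 1) := by
          gcongr
          linarith [Real.add_one_le_exp (-ρ)]
      _ = _ := by
          rw [← ENNReal.ofReal_pow (Real.exp_pos _).le, ← Real.exp_nat_mul, mul_neg]
  have hone : (1 : ENNReal) ≤ volume (connDB (m + 1) ρ)
      + (m + 1 : ℕ) * ENNReal.ofReal (Real.exp (-((m + 1 : ℕ) * ρ))) :=
    calc (1 : ENNReal) = volume (unitBox (m + 1)) := (volume_unitBox _).symm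
      _ ≤ volume (connDB (m + 1) ρ) + volume (⋃ i : Fin (m + 1), emptyRightOf ρ i) :=
          (measure_mono (unitBox_subset_connDB_union _ _)).trans (measure_union_le _ _)
      _ ≤ _ := by
          gcongr
          refine (measure_iUnion_fintype_le _ _).trans ?_
          refine (Finset.sum_le_sum fun i _ => hbad i).trans ?_
          simp
  have hfin : volume (connDB (m + 1) ρ) ≠ ⊤ :=
    ((volume_connDB_le_one _ _).trans_lt ENNReal.one_lt_top).ne
  have hfin' : ((m + 1 : ℕ) : ENNReal) * ENNReal.ofReal (Real.exp (-((m + 1 : ℕ) * ρ))) ≠ ⊤ :=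
    ENNReal.mul_ne_top (ENNReal.natCast_ne_top _) ENNReal.ofReal_ne_top
  have hreal := ENNReal.toReal_mono (ENNReal.add_ne_top.2 ⟨hfin, hfin'⟩) hone
  rw [ENNReal.toReal_add hfin hfin', ENNReal.toReal_mul, ENNReal.toReal_natCast,
    ENNReal.toReal_ofReal (Real.exp_pos _).le, ENNReal.toReal_one] at hreal
  exact sub_le_iff_le_add.2 hreal

/-- if eventually `n·r(n) ≥ (1+ε)·ℓ(n)·ln n`, then the probability of
connectedness (disconnected boundary conditions, normalized range `ρ_n = r(n)/ℓ(n)`)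
tends to `1`. -/
theorem P_connDB_supercritical (r ℓ : ℕ → ℝ) (hr : ∀ n, 0 < r n) (hℓ : ∀ n, 0 < ℓ n)
    (h : ∃ ε > (0 : ℝ), ∃ N : ℕ, ∀ n ≥ N, (1 + ε) * (ℓ n * Real.log n) ≤ (n : ℝ) * r n) :
    Tendsto (fun n : ℕ => P_connDB n (r n / ℓ n)) atTop (nhds 1) := by
  obtain ⟨ε, hε, N, hN⟩ := h
  have hlim : Tendsto (fun n : ℕ => 1 - Real.exp (-(ε * Real.log n))) atTop (nhds 1) := by
    have hlog : Tendsto (fun n : ℕ => ε * Real.log n) atTop atTop :=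
      (Real.tendsto_log_atTop.comp tendsto_natCast_atTop_atTop).const_mul_atTop hε
    simpa using (Real.tendsto_exp_neg_atTop_nhds_zero.comp hlog).const_sub 1
  refine tendsto_of_tendsto_of_tendsto_of_le_of_le' hlim tendsto_const_nhds ?_
    (Eventually.of_forall fun n => P_connDB_le_one n _)
  filter_upwards [eventually_ge_atTop N, eventually_gt_atTop 0] with n hnN hn
  refine le_trans ?_ (one_sub_le_P_connDB hn.ne' (div_pos (hr n) (hℓ n)))
  have hn' : (0 : ℝ) < n := Nat.cast_pos.2 hn
  have hρ : (1 + ε) * Real.log n ≤ n * (r n / ℓ n) := by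
    rw [← mul_div_assoc, le_div_iff₀ (hℓ n)]
    linarith [hN n hnN]
  have hexp : n * Real.exp (-(n * (r n / ℓ n))) ≤ Real.exp (-(ε * Real.log n)) := by
    calc n * Real.exp (-(n * (r n / ℓ n)))
        = Real.exp (Real.log n + -(n * (r n / ℓ n))) := by rw [Real.exp_add, Real.exp_log hn']
      _ ≤ Real.exp (-(ε * Real.log n)) := Real.exp_le_exp.2 (by linarith)
  linarith
end
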